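/- arXiv:2404.16427 — 3 statements merged into one kernel-verified Lean document; each statement's English description precedes it below -/
import Mathlib

section
/- Let k be an algebraic closure of 𝔽_q(t), where q is a power of the prime p. Let s_1,…,s_r be positive integers such that s_i/s_j is not an integer power of p for all i ≠ j. Equip V = k^{r+1} with the action of k^× given by a·(x_0,x_1,…,x_r) := (x_0, a^{s_1}x_1,…,a^{s_r}x_r). Let W ⊆ V be an additive subgroup that is Zariski closed (i.e., W is the common zero set in k^{r+1} of a family of polynomials in r+1 variables over k), whose points are stable under the k^×-action, such that the projection (x_0,…,x_r) ↦ x_0 maps W onto k, and the projection (x_0,x_1,…,x_r) ↦ (x_1,…,x_r) maps W onto k^r. Then W = V. -/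
/-- The image of the variable in an algebraic closure of `F(t)` is not a root of unity. -/
theorem algebraMap_ratFunc_X_pow_ne_one (F : Type*) [Field F] {n : ℕ} (hn : 0 < n) :
    (algebraMap (RatFunc F) (AlgebraicClosure (RatFunc F)) RatFunc.X) ^ n ≠ 1 := by
  intro h
  rw [← map_pow, map_eq_one_iff _ (algebraMap (RatFunc F) _).injective,
    ← RatFunc.algebraMap_X, ← map_pow,
    map_eq_one_iff _ (RatFunc.algebraMap_injective F)] at h
  have hdeg := congrArg Polynomial.natDegree h
  simp only [Polynomial.natDegree_X_pow, Polynomial.natDegree_one] at hdeg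
  omega


/-- Let `k` be an algebraic closure of `𝔽_q(t)` (char `p`). Let
`V = k^{r+1}` carry the `k^×`-action `a·(x₀,x₁,…,x_r) = (x₀, a^{s₁}x₁,…,a^{s_r}x_r)`,
where no ratio `s_i/s_j` (`i ≠ j`) is an integer power of `p`. If `W ≤ V` is a
Zariski-closed additive subgroup, stable under the action, mapping onto `k` by the
`x₀`-coordinate and onto `k^r` by the remaining coordinates, then `W = V`. -/
theorem statement8 (p q r : ℕ) [Fact p.Prime] (hq : ∃ e : ℕ, 0 < e ∧ q = p ^ e)
    (Fq : Type) [Field Fq] [Fintype Fq] (hcard : Fintype.card Fq = q)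
    (s : Fin r → ℕ) (hs : ∀ i, 0 < s i)
    (hratio : ∀ i j : Fin r, i ≠ j → ∀ z : ℤ, ((s i : ℚ) / (s j : ℚ)) ≠ (p : ℚ) ^ z)
    (W : AddSubgroup (Fin (r + 1) → AlgebraicClosure (RatFunc Fq)))
    (hclosed : ∃ S : Set (MvPolynomial (Fin (r + 1)) (AlgebraicClosure (RatFunc Fq))),
      (W : Set (Fin (r + 1) → AlgebraicClosure (RatFunc Fq)))
        = {x | ∀ P ∈ S, MvPolynomial.eval x P = 0})
    (hstable : ∀ a : AlgebraicClosure (RatFunc Fq), a ≠ 0 → ∀ x ∈ W,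
      (Fin.cons (x 0) (fun j : Fin r => a ^ s j * x j.succ) :
        Fin (r + 1) → AlgebraicClosure (RatFunc Fq)) ∈ W)
    (hsurj0 : ∀ c : AlgebraicClosure (RatFunc Fq), ∃ x ∈ W, x 0 = c)
    (hsurj1 : ∀ v : Fin r → AlgebraicClosure (RatFunc Fq),
      ∃ x ∈ W, ∀ j : Fin r, x j.succ = v j) :
    W = ⊤ := by
  set a := algebraMap (RatFunc Fq) (AlgebraicClosure (RatFunc Fq)) RatFunc.X with ha
  have ha0 : a ≠ 0 := by simp [ha, RatFunc.X_ne_zero]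
  have ha1 : ∀ j, a ^ s j - 1 ≠ 0 := fun j =>
    sub_ne_zero.mpr (algebraMap_ratFunc_X_pow_ne_one Fq (hs j))
  -- For `x ∈ W`, the element `a • x - x` kills the first coordinate and scales the others.
  have hzero : ∀ v : Fin r → AlgebraicClosure (RatFunc Fq),
      (Fin.cons 0 v : Fin (r + 1) → AlgebraicClosure (RatFunc Fq)) ∈ W := by
    intro v
    obtain ⟨x, hx, hxv⟩ := hsurj1 fun j => v j / (a ^ s j - 1)
    convert W.sub_mem (hstable a ha0 x hx) hx using 1
    ext j
    refine Fin.cases ?_ (fun j => ?_) j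
    · simp
    · have := ha1 j
      simp only [Fin.cons_succ, Pi.sub_apply, hxv]
      field_simp
  refine (AddSubgroup.eq_top_iff' W).mpr fun y => ?_
  obtain ⟨x, hx, hx0⟩ := hsurj0 (y 0)
  convert W.add_mem hx (hzero fun j => y j.succ - x j.succ) using 1
  ext j
  refine Fin.cases ?_ (fun j => ?_) j <;> simp [hx0]
end

section
/- Let k be an infinite field of characteristic p > 0. Call a polynomial P ∈ k[X] additive if it has the form P(X) = Σ_{j=0}^{m} b_j X^{p^j}. Let s_1,…,s_r be positive integers such that s_i/s_j is not an integer power of p for all i ≠ j, let P_0, P_1,…,P_r ∈ k[X] be additive polynomials, and let b ∈ k. If P_0(b) + P_1(a^{s_1}) + ⋯ + P_r(a^{s_r}) = 0 for every a ∈ k, then P_1 = P_2 = ⋯ = P_r = 0 (as polynomials) and P_0(b) = 0. -/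
/-- Over an infinite field `k` of characteristic `p`, if
`P₀,P₁,…,P_r` are additive polynomials (supported on `p`-power exponents),
`s₁,…,s_r` are positive integers with no ratio `s_i/s_j` (`i ≠ j`) an integer power
of `p`, `b ∈ k`, and `P₀(b) + P₁(a^{s₁}) + ⋯ + P_r(a^{s_r}) = 0` for every `a ∈ k`,
then `P₁ = ⋯ = P_r = 0` and `P₀(b) = 0`. -/
theorem statement9 (p : ℕ) [Fact p.Prime] (k : Type) [Field k] [Infinite k] [CharP k p]
    (r : ℕ) (s : Fin r → ℕ) (hs : ∀ i, 0 < s i)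
    (hratio : ∀ i j : Fin r, i ≠ j → ∀ z : ℤ, ((s i : ℚ) / (s j : ℚ)) ≠ (p : ℚ) ^ z)
    (P0 : Polynomial k) (P : Fin r → Polynomial k)
    (hP0 : ∀ m ∈ P0.support, ∃ j : ℕ, m = p ^ j)
    (hP : ∀ i, ∀ m ∈ (P i).support, ∃ j : ℕ, m = p ^ j)
    (b : k)
    (hvanish : ∀ a : k, P0.eval b + ∑ i, (P i).eval (a ^ s i) = 0) :
    (∀ i, P i = 0) ∧ P0.eval b = 0 := by
  have hp : p.Prime := Fact.out
  have hQ : Polynomial.C (P0.eval b) + ∑ i, Polynomial.expand k (s i) (P i) = 0 := by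
    refine Polynomial.funext fun a => ?_
    simpa [Polynomial.eval_finsetSum, Polynomial.expand_eval] using hvanish a
  have hPzero : ∀ i, P i = 0 := by
    intro i
    ext n
    rw [Polynomial.coeff_zero]
    by_contra hn
    obtain ⟨j, rfl⟩ := hP i n (Polynomial.mem_support_iff.mpr hn)
    have hc := congrArg (fun Q => Polynomial.coeff Q (p ^ j * s i)) hQ
    have hpos : p ^ j * s i ≠ 0 := (Nat.mul_pos (pow_pos hp.pos j) (hs i)).ne'
    simp only [Polynomial.coeff_add, Polynomial.coeff_C, if_neg hpos, zero_add,
      Polynomial.finsetSum_coeff, Polynomial.coeff_zero] at hc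
    rw [Finset.sum_eq_single i, Polynomial.coeff_expand_mul (hs i)] at hc
    · exact hn hc
    · intro l _ hl
      rw [Polynomial.coeff_expand (hs l)]
      split_ifs with hd
      · by_contra hne
        obtain ⟨m, hm⟩ := hP l _ (Polynomial.mem_support_iff.mpr hne)
        have heq : p ^ j * s i = p ^ m * s l := by rw [← hm, Nat.div_mul_cancel hd]
        refine hratio i l hl.symm ((m : ℤ) - j) ?_
        have hp0 : (p : ℚ) ≠ 0 := Nat.cast_ne_zero.mpr hp.ne_zero
        have hl0 : (s l : ℚ) ≠ 0 := Nat.cast_ne_zero.mpr (hs l).ne'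
        rw [zpow_sub₀ hp0, zpow_natCast, zpow_natCast,
          div_eq_div_iff hl0 (pow_ne_zero j hp0), mul_comm]
        exact_mod_cast heq
      · rfl
    · simp
  exact ⟨hPzero, by simpa [hPzero] using hvanish 0⟩
end

section
/- Let R be a commutative ring, d ≥ 1 and m ≥ 0. Define ρ_m : Mat_d(R[X]) → Mat_{d(m+1)}(R[X]) by sending a matrix A to the block lower triangular matrix whose (i,j)-block, for 0 ≤ j ≤ i ≤ m, is the entrywise i−j-th Hasse derivative of A (so the diagonal blocks are A, the first subdiagonal blocks are the entrywise hasseDeriv 1 of A, etc.), and whose blocks above the diagonal are zero. Then ρ_m is a homomorphism of R[X]-algebras: ρ_m is additive, ρ_m(1) = 1, ρ_m(A·B) = ρ_m(A)·ρ_m(B) for all A, B ∈ Mat_d(R[X]), and ρ_m(f·A) = ρ_m(f·I_d)·ρ_m(A) for f ∈ R[X]. In particular, if A is invertible then ρ_m(A) is invertible with inverse ρ_m(A^{−1}). -/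
noncomputable section

/-- The `m`-th prolongation map `ρ_m : Mat_d(R[X]) → Mat_{d(m+1)}(R[X])`:
block lower triangular, with `(i,j)`-block (for `j ≤ i`) the entrywise
`(i−j)`-th Hasse derivative of `A`, and zero blocks above the diagonal. -/
def rhoMat (R : Type*) [CommRing R] (d m : ℕ)
    (A : Matrix (Fin d) (Fin d) (Polynomial R)) :
    Matrix (Fin (m + 1) × Fin d) (Fin (m + 1) × Fin d) (Polynomial R) :=
  fun ik jl =>
    if (jl.1 : ℕ) ≤ (ik.1 : ℕ) then
      Polynomial.hasseDeriv ((ik.1 : ℕ) - (jl.1 : ℕ)) (A ik.2 jl.2)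
    else 0

/-- The product of two truncated lower triangular Toeplitz matrices, entrywise, is the Cauchy
product of their defining sequences. -/
theorem sum_toeplitz_mul_toeplitz {S : Type*} [NonUnitalNonAssocSemiring S] {n : ℕ} (u v : ℕ → S)
    (i j : Fin n) :
    (∑ k : Fin n, (if (k : ℕ) ≤ i then u ((i : ℕ) - k) else 0) *
        (if (j : ℕ) ≤ k then v ((k : ℕ) - j) else 0)) =
      if (j : ℕ) ≤ i then ∑ p ∈ Finset.HasAntidiagonal.antidiagonal ((i : ℕ) - j),
        u p.1 * v p.2 else 0 := by
  simp only [ite_zero_mul_ite_zero]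
  rw [← Finset.sum_filter]
  split_ifs with hji
  · refine Finset.sum_bij' (fun k _ => ((i : ℕ) - k, (k : ℕ) - j))
      (fun p hp => ⟨j + p.2, by have := Finset.HasAntidiagonal.mem_antidiagonal.mp hp; omega⟩)
      ?_ ?_ ?_ ?_ ?_
    all_goals
      simp only [Finset.mem_filter, Finset.mem_univ, true_and,
        Finset.HasAntidiagonal.mem_antidiagonal, Prod.forall, Fin.ext_iff, Prod.mk.injEq]
      grind
  · refine Finset.sum_eq_zero fun k hk => ?_
    grind

theorem rhoMat_add {R : Type*} [CommRing R] {d : ℕ} (m : ℕ)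
    (A B : Matrix (Fin d) (Fin d) (Polynomial R)) :
    rhoMat R d m (A + B) = rhoMat R d m A + rhoMat R d m B := by
  ext1 ⟨i, a⟩ ⟨j, b⟩
  by_cases h : (j : ℕ) ≤ i <;> simp [rhoMat, h]

theorem rhoMat_one {R : Type*} [CommRing R] {d : ℕ} (m : ℕ) : rhoMat R d m 1 = 1 := by
  ext1 ⟨i, a⟩ ⟨j, b⟩
  rcases lt_trichotomy (j : ℕ) i with h | h | h
  · have hne : i ≠ j := by omega
    simp only [rhoMat, if_pos h.le, Matrix.one_apply, Prod.mk.injEq, hne, false_and, if_false]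
    split_ifs
    · exact Polynomial.hasseDeriv_apply_one _ (by omega)
    · exact map_zero _
  · obtain rfl := Fin.ext h
    simp [rhoMat, Matrix.one_apply]
  · have hne : i ≠ j := by omega
    simp only [rhoMat, if_neg h.not_ge, Matrix.one_apply, Prod.mk.injEq, hne, false_and, if_false]

theorem rhoMat_mul {R : Type*} [CommRing R] {d : ℕ} (m : ℕ)
    (A B : Matrix (Fin d) (Fin d) (Polynomial R)) :
    rhoMat R d m (A * B) = rhoMat R d m A * rhoMat R d m B := by
  ext1 ⟨i, a⟩ ⟨j, b⟩
  simp only [rhoMat, Matrix.mul_apply, Fintype.sum_prod_type_right, map_sum,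
    Polynomial.hasseDeriv_mul]
  rw [Finset.sum_congr rfl fun c _ => sum_toeplitz_mul_toeplitz
    (fun n => Polynomial.hasseDeriv n (A a c)) (fun n => Polynomial.hasseDeriv n (B c b)) i j]
  split_ifs <;> simp

/-- `ρ_m` is a homomorphism of `R[X]`-algebras: additive, unital,
multiplicative, compatible with scalar multiplication by `R[X]`, and it sends
(two-sided) inverses to inverses. -/
theorem statement13 (R : Type*) [CommRing R] (d m : ℕ) :
    (∀ A B : Matrix (Fin d) (Fin d) (Polynomial R),
      rhoMat R d m (A + B) = rhoMat R d m A + rhoMat R d m B) ∧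
    rhoMat R d m 1 = 1 ∧
    (∀ A B : Matrix (Fin d) (Fin d) (Polynomial R),
      rhoMat R d m (A * B) = rhoMat R d m A * rhoMat R d m B) ∧
    (∀ (f : Polynomial R) (A : Matrix (Fin d) (Fin d) (Polynomial R)),
      rhoMat R d m (f • A)
        = rhoMat R d m (f • (1 : Matrix (Fin d) (Fin d) (Polynomial R)))
            * rhoMat R d m A) ∧
    (∀ A B : Matrix (Fin d) (Fin d) (Polynomial R), A * B = 1 → B * A = 1 →
      rhoMat R d m A * rhoMat R d m B = 1 ∧ rhoMat R d m B * rhoMat R d m A = 1) := by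
  refine ⟨rhoMat_add m, rhoMat_one m, rhoMat_mul m, fun f A => ?_, fun A B hAB hBA => ?_⟩
  · rw [← rhoMat_mul, smul_mul_assoc, one_mul]
  · rw [← rhoMat_mul, ← rhoMat_mul, hAB, hBA]
    exact ⟨rhoMat_one m, rhoMat_one m⟩
end
end
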